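/- Let n range over an increasing sequence of integers along which f(k0(n)) → ∞ and f(k0(n)+1) → 0. Then for G = G(n,1/2), the probability that both α(G) = k0(n) and β(G) = k0(n)+2 tends to 1 as n tends to infinity; consequently, the probability that τ(G) ≤ n − α(G) − 1 tends to 1. -/

import Mathlib

open MeasureTheory ProbabilityTheory Filter Real

namespace RandomBipartiteDecomposition

/-- The set of edges of the complete bipartite graph with vertex classes `A` and `B`. -/
def bicliqueEdges {V : Type*} (A B : Finset V) : Set (Sym2 V) :=
  {e | ∃ a ∈ A, ∃ b ∈ B, e = s(a, b)}

/-- `A`, `B` are the vertex classes of a complete bipartite subgraph of `G`. -/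
def IsBicliqueIn {V : Type*} (G : SimpleGraph V) (A B : Finset V) : Prop :=
  A.Nonempty ∧ B.Nonempty ∧ Disjoint A B ∧ ∀ a ∈ A, ∀ b ∈ B, G.Adj a b

/-- A complete bipartite subgraph is nontrivial if both classes have at least 2 vertices. -/
def IsNontrivialBicliqueIn {V : Type*} (G : SimpleGraph V) (A B : Finset V) : Prop :=
  2 ≤ A.card ∧ 2 ≤ B.card ∧ Disjoint A B ∧ ∀ a ∈ A, ∀ b ∈ B, G.Adj a b

/-- `P` lists `m` pairwise edge-disjoint complete bipartite subgraphs of `G` such that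
every edge of `G` belongs to exactly one of them. -/
def IsBicliqueDecomp {V : Type*} (G : SimpleGraph V) (m : ℕ)
    (P : Fin m → Finset V × Finset V) : Prop :=
  (∀ i, IsBicliqueIn G (P i).1 (P i).2) ∧
  (∀ i j, i ≠ j →
    Disjoint (bicliqueEdges (P i).1 (P i).2) (bicliqueEdges (P j).1 (P j).2)) ∧
  (⋃ i, bicliqueEdges (P i).1 (P i).2) = G.edgeSet

/-- As above but with all complete bipartite subgraphs nontrivial. -/
def IsNontrivialBicliqueDecomp {V : Type*} (G : SimpleGraph V) (m : ℕ)
    (P : Fin m → Finset V × Finset V) : Prop :=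
  (∀ i, IsNontrivialBicliqueIn G (P i).1 (P i).2) ∧
  (∀ i j, i ≠ j →
    Disjoint (bicliqueEdges (P i).1 (P i).2) (bicliqueEdges (P j).1 (P j).2)) ∧
  (⋃ i, bicliqueEdges (P i).1 (P i).2) = G.edgeSet

/-- `τ(G)`: the minimum number of pairwise edge-disjoint complete bipartite subgraphs
of `G` so that each edge of `G` belongs to exactly one of them. -/
noncomputable def tau {V : Type*} (G : SimpleGraph V) : ℕ :=
  sInf {m | ∃ P : Fin m → Finset V × Finset V, IsBicliqueDecomp G m P}

/-- `τ'(G)`: the minimum number of pairwise edge-disjoint *nontrivial* complete bipartite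
subgraphs of `G` covering all edges of `G`; `⊤` if there is no such cover. -/
noncomputable def tau' {V : Type*} (G : SimpleGraph V) : ℕ∞ :=
  sInf {t : ℕ∞ | ∃ m : ℕ, t = m ∧ ∃ P : Fin m → Finset V × Finset V,
    IsNontrivialBicliqueDecomp G m P}

/-- `S` is an independent set of `G`. -/
def IsIndepFinset {V : Type*} (G : SimpleGraph V) (S : Finset V) : Prop :=
  ∀ a ∈ S, ∀ b ∈ S, ¬ G.Adj a b

/-- `α(G)`: the maximum size of an independent set of `G`. -/
noncomputable def alpha {V : Type*} (G : SimpleGraph V) : ℕ :=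
  sSup {k | ∃ S : Finset V, S.card = k ∧ IsIndepFinset G S}

/-- `S` induces in `G` a complete bipartite graph with nonempty vertex classes `A`, `B`. -/
def IsInducedCompleteBipartite {V : Type*} (G : SimpleGraph V) (S A B : Finset V) : Prop :=
  A.Nonempty ∧ B.Nonempty ∧ Disjoint A B ∧ (A : Set V) ∪ (B : Set V) = (S : Set V) ∧
  ∀ u ∈ S, ∀ v ∈ S, (G.Adj u v ↔ ((u ∈ A ∧ v ∈ B) ∨ (u ∈ B ∧ v ∈ A)))

/-- `β(G)`: the largest number of vertices of an induced complete bipartite subgraph. -/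
noncomputable def beta {V : Type*} (G : SimpleGraph V) : ℕ :=
  sSup {k | ∃ S A B : Finset V, IsInducedCompleteBipartite G S A B ∧ S.card = k}

/-- The Bernoulli measure on `Bool` giving `true` probability `p`. -/
noncomputable def bernoulliBool (p : ℝ) : Measure Bool :=
  p.toNNReal • Measure.dirac true + (1 - p).toNNReal • Measure.dirac false

instance (p : ℝ) : IsFiniteMeasure (bernoulliBool p) := by
  unfold bernoulliBool; infer_instance

/-- The Erdős–Rényi random graph `G(n,p)`: each unordered pair of vertices flips an
independent `p`-coin. Events about the graph are subsets of the coin-flip space. -/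
noncomputable def erdosRenyi (n : ℕ) (p : ℝ) : Measure (Sym2 (Fin n) → Bool) :=
  Measure.pi fun _ => bernoulliBool p

/-- The simple graph determined by the coin flips `ω`. -/
def graphOf (n : ℕ) (ω : Sym2 (Fin n) → Bool) : SimpleGraph (Fin n) :=
  SimpleGraph.fromEdgeSet {e | ω e = true}

/-- `f(k) = C(n,k) · 2^{-C(k,2)}`, the expected number of independent sets of size `k`
in `G(n,1/2)`. -/
noncomputable def f (n k : ℕ) : ℝ :=
  (n.choose k : ℝ) * (2 : ℝ) ^ (-(k.choose 2 : ℤ))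

/-- `k₀(n)`: the largest `k` with `f(k) ≥ 1`. -/
noncomputable def k0 (n : ℕ) : ℕ := sSup {k | 1 ≤ f n k}

/-- `g(k) = C(n,k+2) · (2^{k+1} - 1) · 2^{-C(k+2,2)}`, the expected number of induced
complete bipartite subgraphs on `k+2` vertices in `G(n,1/2)`. -/
noncomputable def g (n k : ℕ) : ℝ :=
  (n.choose (k + 2) : ℝ) * ((2 : ℝ) ^ (k + 1) - 1) * (2 : ℝ) ^ (-((k + 2).choose 2 : ℤ))

/-- The number of independent sets of size `k` in the graph determined by `ω`. -/
noncomputable def numIndep (n k : ℕ) (ω : Sym2 (Fin n) → Bool) : ℕ :=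
  Set.ncard {S : Finset (Fin n) | S.card = k ∧ IsIndepFinset (graphOf n ω) S}

/-- The number of `m`-element vertex subsets inducing a complete bipartite graph in the
graph determined by `ω`. -/
noncomputable def numBip (n m : ℕ) (ω : Sym2 (Fin n) → Bool) : ℕ :=
  Set.ncard {S : Finset (Fin n) | S.card = m ∧
    ∃ A B : Finset (Fin n), IsInducedCompleteBipartite (graphOf n ω) S A B}

/-- The expected number of `i`-sets of vertices satisfying a system of `(i - c).choose 2`
independent parity constraints on their edges in `G(n,1/2)`. -/
noncomputable def expCount (c n i : ℕ) : ℝ := (n.choose i : ℝ) / 2 ^ (i - c).choose 2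

lemma f_eq_expCount (n k : ℕ) : f n k = expCount 0 n k := by
  simp [f, expCount, zpow_neg, div_eq_mul_inv]

lemma expCount_pos {c n i : ℕ} (h : i ≤ n) : 0 < expCount c n i := by
  have : 0 < n.choose i := Nat.choose_pos h
  unfold expCount; positivity

lemma expCount_succ {c n i : ℕ} (hc : c ≤ i) :
    expCount c n (i + 1) * ((i + 1) * 2 ^ (i - c)) = expCount c n i * (n - i : ℕ) := by
  have h := congrArg (Nat.cast (R := ℝ)) (Nat.choose_succ_right_eq n i)
  push_cast at h
  have h2 : (i + 1 - c).choose 2 = (i - c).choose 2 + (i - c) := by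
    rw [Nat.succ_sub hc, Nat.choose_succ_succ' _ 1, Nat.choose_one_right, add_comm]
  unfold expCount
  rw [h2, pow_add]
  field_simp
  linarith

lemma pow_div_le_choose {n k : ℕ} (hk : k ≤ n) : ((n : ℝ) / k) ^ k ≤ n.choose k := by
  induction k generalizing n with
  | zero => simp
  | succ k ih =>
    obtain ⟨n, rfl⟩ : ∃ l, n = l + 1 := ⟨n - 1, by omega⟩
    have hkn : k ≤ n := by omega
    have h := congrArg (Nat.cast (R := ℝ)) (Nat.add_one_mul_choose_eq n k)
    push_cast at h ⊢
    have hc : ((n + 1).choose (k + 1) : ℝ) = ((n : ℝ) + 1) / (k + 1) * n.choose k := by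
      field_simp; linarith
    rw [hc, pow_succ, mul_comm]
    refine mul_le_mul_of_nonneg_left (le_trans ?_ (ih hkn)) (by positivity)
    rcases Nat.eq_zero_or_pos k with rfl | hk0
    · simp
    refine pow_le_pow_left₀ (by positivity) ?_ k
    have : (k : ℝ) ≤ n := by exact_mod_cast hkn
    have : (0 : ℝ) < k := by exact_mod_cast hk0
    rw [div_le_div_iff₀ (by positivity) (by positivity)]
    nlinarith

lemma f_lt_one_of_le {n k : ℕ} (hn : 2 ≤ n) (hk : n ≤ k) : f n k < 1 := by
  rw [f_eq_expCount, expCount, Nat.sub_zero]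
  have h1 : n.choose k ≤ 1 := by
    rcases hk.eq_or_lt with rfl | h
    · simp
    · simp [Nat.choose_eq_zero_of_lt h]
  have h2 : 0 < k.choose 2 := Nat.choose_pos (by omega)
  have h3 : (1 : ℝ) < 2 ^ k.choose 2 := one_lt_pow₀ (by norm_num) h2.ne'
  rw [div_lt_one (by positivity)]
  have : (n.choose k : ℝ) ≤ 1 := by exact_mod_cast h1
  linarith

lemma bddAbove_one_le_f {n : ℕ} (hn : 2 ≤ n) : BddAbove {k | 1 ≤ f n k} :=
  ⟨n, fun _ hk => le_of_not_ge fun h => absurd hk (f_lt_one_of_le hn h).not_ge⟩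

lemma one_le_f_k0 {n : ℕ} (hn : 2 ≤ n) : 1 ≤ f n (k0 n) :=
  Nat.sSup_mem (s := {k | 1 ≤ f n k}) ⟨0, by simp [f]⟩ (bddAbove_one_le_f hn)

lemma f_k0_add_one_lt {n : ℕ} (hn : 2 ≤ n) : f n (k0 n + 1) < 1 := by
  by_contra! h
  have := le_csSup (bddAbove_one_le_f hn) h
  simp only [k0] at this
  omega

lemma k0_lt {n : ℕ} (hn : 2 ≤ n) : k0 n < n := by
  by_contra! h
  exact absurd (one_le_f_k0 hn) (f_lt_one_of_le hn h).not_ge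

lemma two_mul_choose_two (i : ℕ) : i.choose 2 * 2 = i * (i - 1) := by
  rw [Nat.choose_two_right, Nat.div_mul_cancel (Nat.even_mul_pred_self i).two_dvd]

lemma sq_le_two_pow_k0 {n : ℕ} (hn : 2 ≤ n) :
    (n : ℝ) ^ 2 ≤ 2 ^ k0 n * ((k0 n : ℝ) + 1) ^ 2 := by
  have h := f_k0_add_one_lt hn
  have hk := k0_lt hn
  set k := k0 n
  rw [f_eq_expCount, expCount, Nat.sub_zero, div_lt_one (by positivity)] at h
  have h1 := (pow_div_le_choose (n := n) (k := k + 1) hk).trans_lt h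
  have h2 : (((n : ℝ) / (k + 1 : ℕ)) ^ 2) ^ (k + 1) < ((2 : ℝ) ^ k) ^ (k + 1) := by
    rw [← pow_mul, mul_comm 2, pow_mul, ← pow_mul 2 k, mul_comm k]
    have := two_mul_choose_two (k + 1)
    simp only [Nat.add_sub_cancel] at this
    rw [← this, pow_mul 2 _ 2]
    exact pow_lt_pow_left₀ h1 (by positivity) (by norm_num)
  have h3 := lt_of_pow_lt_pow_left₀ _ (by positivity) h2
  rw [div_pow, div_lt_iff₀ (by positivity)] at h3
  push_cast at h3
  exact h3.le

lemma two_pow_k0_mul_le {n : ℕ} (hn : 2 ≤ n) (hk1 : 1 ≤ k0 n) :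
    (2 : ℝ) ^ k0 n * (k0 n : ℝ) ^ 2 ≤ 16 * n ^ 2 := by
  have h := one_le_f_k0 hn
  set k := k0 n
  rw [f_eq_expCount, expCount, Nat.sub_zero, one_le_div (by positivity)] at h
  have h1 := Nat.choose_le_pow_div (α := ℝ) k n
  have h2 := Real.pow_div_factorial_le_exp (k : ℝ) (by positivity) k
  have hkpos : (0 : ℝ) < k := by exact_mod_cast hk1
  have h3 : (2 : ℝ) ^ k.choose 2 * k ^ k ≤ (n * Real.exp 1) ^ k := by
    rw [mul_pow, ← Real.exp_nat_mul, mul_one]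
    calc (2 : ℝ) ^ k.choose 2 * k ^ k ≤ (n ^ k / k.factorial) * k ^ k := by
          gcongr; exact h.trans h1
      _ = n ^ k * (k ^ k / k.factorial) := by ring
      _ ≤ _ := by gcongr
  have h4 : ((2 : ℝ) ^ (k - 1) * k ^ 2) ^ k ≤ ((n * Real.exp 1) ^ 2) ^ k := by
    have e1 : ((2 : ℝ) ^ (k - 1) * k ^ 2) ^ k = (2 ^ k.choose 2 * k ^ k) ^ 2 := by
      rw [mul_pow, mul_pow, ← pow_mul, ← pow_mul 2 _ 2, two_mul_choose_two, mul_comm (k - 1),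
        ← pow_mul, ← pow_mul, mul_comm 2 k]
    rw [e1, ← pow_mul, mul_comm 2 k, pow_mul]
    exact pow_le_pow_left₀ (by positivity) h3 2
  have h5 := le_of_pow_le_pow_left₀ (by omega) (by positivity) h4
  have h6 : (2 : ℝ) ^ k = 2 * 2 ^ (k - 1) := by rw [← pow_succ']; congr 1; omega
  have h7 : Real.exp 1 ^ 2 ≤ 8 := by
    have := Real.exp_one_lt_d9
    have := Real.exp_pos 1
    nlinarith
  rw [h6]
  nlinarith [sq_nonneg (n : ℝ), mul_le_mul_of_nonneg_left h7 (sq_nonneg (n : ℝ))]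

lemma tendsto_k0 : Tendsto k0 atTop atTop := by
  refine tendsto_atTop.2 fun K => ?_
  have : Tendsto (fun n : ℕ => (n : ℝ) ^ 2) atTop atTop :=
    (tendsto_pow_atTop two_ne_zero).comp tendsto_natCast_atTop_atTop
  filter_upwards [this.eventually_gt_atTop ((2 : ℝ) ^ K * ((K : ℝ) + 1) ^ 2),
    eventually_ge_atTop 2] with n h hn
  by_contra! hlt
  refine absurd (sq_le_two_pow_k0 hn) (not_le.2 (lt_of_le_of_lt ?_ h))
  gcongr
  norm_num

lemma eventually_pow_le_k0 : ∀ᶠ n : ℕ in atTop, (k0 n + 2) ^ 11 ≤ n := by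
  have h : ∀ᶠ k : ℕ in atTop, ((k : ℝ) + 2) ^ 22 ≤ 2 ^ k := by
    have h1 := tendsto_pow_const_div_const_pow_of_one_lt 22 (r := (2 : ℝ)) (by norm_num)
    have h2 := (tendsto_add_atTop_iff_nat 2).2 h1
    filter_upwards [h2.eventually_lt_const (show (0 : ℝ) < 1 / 4 by norm_num)] with k hk
    push_cast at hk
    rw [div_lt_iff₀ (by positivity), pow_add] at hk
    linarith
  filter_upwards [tendsto_k0.eventually h, tendsto_k0.eventually_ge_atTop 4,
    eventually_ge_atTop 2] with n h1 h2 hn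
  have h3 := two_pow_k0_mul_le hn (by omega)
  have h4 : (4 : ℝ) ≤ k0 n := by exact_mod_cast h2
  have h5 : (2 : ℝ) ^ k0 n ≤ n ^ 2 := by
    have : (0 : ℝ) < 2 ^ k0 n := by positivity
    nlinarith [mul_le_mul_of_nonneg_left (show (16 : ℝ) ≤ (k0 n : ℝ) ^ 2 by nlinarith) this.le]
  have h6 : (((k0 n : ℝ) + 2) ^ 11) ^ 2 ≤ (n : ℝ) ^ 2 := by
    rw [← pow_mul]; exact h1.trans h5
  exact_mod_cast le_of_pow_le_pow_left₀ two_ne_zero (by positivity) h6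

lemma expCount_add_two (n k : ℕ) :
    expCount 1 n (k + 2) * ((k + 1) * (k + 2) * 2 ^ k) =
      f n k * ((n - k : ℕ) * (n - (k + 1) : ℕ)) := by
  have h1 := congrArg (Nat.cast (R := ℝ)) (Nat.choose_succ_right_eq n k)
  have h2 := congrArg (Nat.cast (R := ℝ)) (Nat.choose_succ_right_eq n (k + 1))
  push_cast at h1 h2
  have h3 : (k + 2 - 1).choose 2 = k.choose 2 + k := by
    rw [show k + 2 - 1 = k + 1 by omega, Nat.choose_succ_succ' _ 1, Nat.choose_one_right, add_comm]
  rw [f_eq_expCount, expCount, expCount, h3, pow_add, Nat.sub_zero]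
  field_simp
  linear_combination (k + 1 : ℝ) * h2 + ((n - (k + 1) : ℕ) : ℝ) * h1

lemma f_k0_le_expCount {n : ℕ} (hk : 2 ≤ k0 n) (hn : (k0 n + 2) ^ 11 ≤ n) :
    f n (k0 n) / 256 ≤ expCount 1 n (k0 n + 2) := by
  have hn2 : 2 * (k0 n + 2) ≤ n := by
    refine le_trans ?_ hn
    rw [pow_succ]
    gcongr
    exact le_trans (by omega) (Nat.le_self_pow (by norm_num) (k0 n + 2))
  have h1 := expCount_add_two n (k0 n)
  have h2 := two_pow_k0_mul_le (by omega) (by omega : 1 ≤ k0 n)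
  have hf : 0 ≤ f n (k0 n) := zero_le_one.trans (one_le_f_k0 (by omega))
  set k := k0 n
  have ha : (n : ℝ) / 2 ≤ (n - k : ℕ) := by
    rw [div_le_iff₀ two_pos]; exact_mod_cast (by omega : n ≤ (n - k) * 2)
  have hb : (n : ℝ) / 2 ≤ (n - (k + 1) : ℕ) := by
    rw [div_le_iff₀ two_pos]; exact_mod_cast (by omega : n ≤ (n - (k + 1)) * 2)
  have hk2 : (2 : ℝ) ≤ k := by exact_mod_cast hk
  have hD : ((k : ℝ) + 1) * (k + 2) * 2 ^ k ≤ 64 * n ^ 2 := by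
    have : ((k : ℝ) + 1) * (k + 2) ≤ 4 * k ^ 2 := by nlinarith
    nlinarith [mul_le_mul_of_nonneg_right this (pow_nonneg zero_le_two k : (0 : ℝ) ≤ 2 ^ k)]
  have hpos : (0 : ℝ) < (k + 1) * (k + 2) * 2 ^ k := by positivity
  refine le_of_mul_le_mul_right ?_ hpos
  rw [h1]
  calc f n k / 256 * ((k + 1) * (k + 2) * 2 ^ k) ≤ f n k / 256 * (64 * n ^ 2) := by gcongr
    _ = f n k * (n / 2 * (n / 2)) := by ring
    _ ≤ _ := by gcongr

lemma expCount_le_f_k0_add_one {n : ℕ} (hn : 2 ≤ n) :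
    expCount 1 n (k0 n + 3) ≤ f n (k0 n + 1) := by
  have h1 := expCount_add_two n (k0 n + 1)
  have h2 := sq_le_two_pow_k0 hn
  set k := k0 n
  have hf : 0 ≤ f n (k + 1) := by unfold f; positivity
  have ha : ((n - (k + 1) : ℕ) : ℝ) ≤ n := by exact_mod_cast Nat.sub_le _ _
  have hb : ((n - (k + 1 + 1) : ℕ) : ℝ) ≤ n := by exact_mod_cast Nat.sub_le _ _
  push_cast at h1
  have hpos : (0 : ℝ) < (k + 1 + 1) * (k + 1 + 2) * 2 ^ (k + 1) := by positivity
  refine le_of_mul_le_mul_right ?_ hpos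
  rw [show k + 3 = k + 1 + 2 by omega, h1]
  refine mul_le_mul_of_nonneg_left ?_ hf
  calc _ ≤ (n : ℝ) * n := by gcongr
    _ ≤ 2 ^ k * ((k : ℝ) + 1) ^ 2 := by rw [← sq]; exact h2
    _ ≤ (((k : ℝ) + 1 + 1) * (k + 1 + 2)) * 2 ^ (k + 1) := by
      rw [mul_comm, pow_succ' 2 k]
      gcongr ?_ * ?_
      · nlinarith [(Nat.cast_nonneg k : (0 : ℝ) ≤ k)]
      · have : (0 : ℝ) < 2 ^ k := by positivity
        linarith

/-- The `i`-th term of the normalized second moment bound for `m`-sets. -/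
noncomputable def overlapTerm (c n m i : ℕ) : ℝ :=
  (m.choose i : ℝ) ^ 2 * 2 ^ (i - c).choose 2 / n.choose i

lemma overlapTerm_le_of_small {c n m i : ℕ} (hi : 2 ≤ i) (him : i ≤ m) (hmn : m ≤ n)
    (h : (2 : ℝ) ^ (i - 1) * m ^ 8 ≤ n ^ 2) : overlapTerm c n m i ≤ 1 / m ^ 2 := by
  have hi0 : (0 : ℝ) < i := by exact_mod_cast (by omega : 0 < i)
  have hm0 : (0 : ℝ) < m := by exact_mod_cast (by omega : 0 < m)
  have hn0 : (0 : ℝ) < n := by exact_mod_cast (by omega : 0 < n)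
  have him' : (i : ℝ) ≤ m := by exact_mod_cast him
  have hm1 : (1 : ℝ) ≤ m := by exact_mod_cast (by omega : 1 ≤ m)
  have h1 : overlapTerm c n m i ≤ (m ^ i) ^ 2 * 2 ^ i.choose 2 / (n / i) ^ i := by
    unfold overlapTerm
    gcongr
    · exact_mod_cast Nat.choose_le_pow m i
    · norm_num
    · omega
    · exact pow_div_le_choose (him.trans hmn)
  refine h1.trans ?_
  refine le_of_pow_le_pow_left₀ two_ne_zero (by positivity) ?_
  calc (((m : ℝ) ^ i) ^ 2 * 2 ^ i.choose 2 / (n / i) ^ i) ^ 2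
      = ((m : ℝ) ^ 4 * 2 ^ (i - 1) * i ^ 2 / n ^ 2) ^ i := by
        rw [div_pow, mul_pow _ _ 2, ← pow_mul 2 _ 2, two_mul_choose_two]
        simp only [div_pow, mul_pow, ← pow_mul]
        rw [mul_comm (i - 1) i, mul_comm 4 i, mul_comm 2 i]
        field_simp
        ring_nf
    _ ≤ (1 / (m : ℝ) ^ 2) ^ i := by
        refine pow_le_pow_left₀ (by positivity) ?_ i
        rw [div_le_div_iff₀ (by positivity) (by positivity), one_mul]
        refine le_trans ?_ h
        calc (m : ℝ) ^ 4 * 2 ^ (i - 1) * i ^ 2 * m ^ 2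
            ≤ (m : ℝ) ^ 4 * 2 ^ (i - 1) * m ^ 2 * m ^ 2 := by gcongr
          _ = 2 ^ (i - 1) * (m : ℝ) ^ 8 := by ring
    _ ≤ (1 / (m : ℝ) ^ 2) ^ 2 := by
        refine pow_le_pow_of_le_one (by positivity) ?_ hi
        rw [div_le_one (by positivity)]
        exact one_le_pow₀ hm1

lemma expCount_add_le {c n i : ℕ} (hc : c ≤ 1) (hi : 2 ≤ i) (d : ℕ) :
    expCount c n (i + d) ≤ expCount c n i * (n / 2 ^ (i - 1)) ^ d := by
  induction d with
  | zero => simp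
  | succ d ih =>
    have h := expCount_succ (c := c) (n := n) (i := i + d) (by omega)
    rw [pow_succ, ← mul_assoc, ← add_assoc]
    have h0 : 0 ≤ expCount c n (i + d) := by unfold expCount; positivity
    have hle : expCount c n (i + d + 1) ≤ expCount c n (i + d) * (n / 2 ^ (i - 1)) := by
      have hpos : (0 : ℝ) < ((i + d : ℕ) + 1) * 2 ^ (i + d - c) := by positivity
      refine le_of_mul_le_mul_right ?_ hpos
      rw [h, mul_assoc]
      refine mul_le_mul_of_nonneg_left ?_ h0
      calc ((n - (i + d) : ℕ) : ℝ) ≤ n := by exact_mod_cast Nat.sub_le _ _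
        _ = n / 2 ^ (i - 1) * (1 * 2 ^ (i - 1)) := by field_simp
        _ ≤ _ := by
          gcongr
          · have : (0 : ℝ) ≤ (i + d : ℕ) := by positivity
            linarith
          · norm_num
          · omega
    exact hle.trans (mul_le_mul_of_nonneg_right ih (by positivity))

lemma overlapTerm_eq (c n m i : ℕ) :
    overlapTerm c n m i = (m.choose i : ℝ) ^ 2 / expCount c n i := by
  unfold overlapTerm expCount
  rw [div_div_eq_mul_div]

lemma overlapTerm_le_of_large {c n m i : ℕ} (hc : c ≤ 1) (hi : 2 ≤ i) (him : i < m)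
    (hmn : m ^ 11 ≤ n) (h : (n : ℝ) ^ 2 < 2 ^ (i - 1) * m ^ 8) :
    overlapTerm c n m i ≤ 1 / (m * expCount c n m) := by
  have hmn' : m ≤ n := (Nat.le_self_pow (by norm_num) m).trans hmn
  have hm1 : (1 : ℝ) ≤ m := by exact_mod_cast (by omega : 1 ≤ m)
  have hm0 : (0 : ℝ) < m := by linarith
  have hn0 : (0 : ℝ) < n := by exact_mod_cast (by omega : 0 < n)
  have hmn'' : (m : ℝ) ^ 11 ≤ n := by exact_mod_cast hmn
  have hpos := expCount_pos (c := c) hmn'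
  have hposi := expCount_pos (c := c) (him.le.trans hmn')
  obtain ⟨d, rfl⟩ : ∃ d, m = i + d := ⟨m - i, by omega⟩
  have hd : 1 ≤ d := by omega
  have h1 := expCount_add_le (c := c) (n := n) hc hi d
  set m := i + d with hm
  have hch : (m.choose i : ℝ) ≤ m ^ d := by
    have : m.choose i = m.choose d := by
      rw [← Nat.choose_symm him.le]; congr 1; omega
    rw [this]; exact_mod_cast Nat.choose_le_pow m d
  have h2 : (m : ℝ) ^ 2 * (n / 2 ^ (i - 1)) ≤ 1 / m := by
    have : (n : ℝ) / 2 ^ (i - 1) ≤ m ^ 8 / n := by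
      rw [div_le_div_iff₀ (by positivity) hn0]; nlinarith
    calc (m : ℝ) ^ 2 * (n / 2 ^ (i - 1)) ≤ m ^ 2 * (m ^ 8 / n) := by gcongr
      _ ≤ 1 / (m : ℝ) := by
        rw [← mul_div_assoc, div_le_div_iff₀ hn0 hm0]
        calc (m : ℝ) ^ 2 * m ^ 8 * m = m ^ 11 := by ring
          _ ≤ _ := by linarith
  rw [overlapTerm_eq, div_le_div_iff₀ hposi (by positivity), one_mul]
  calc (m.choose i : ℝ) ^ 2 * (m * expCount c n m)
      ≤ (m ^ d) ^ 2 * (m * (expCount c n i * (n / 2 ^ (i - 1)) ^ d)) := by gcongr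
    _ = (m ^ 2 * (n / 2 ^ (i - 1))) ^ d * m * expCount c n i := by ring
    _ ≤ (1 / m) ^ d * m * expCount c n i := by gcongr
    _ ≤ (1 / m) ^ 1 * m * expCount c n i := by
      gcongr ?_ * _ * _
      exact pow_le_pow_of_le_one (by positivity) (by rw [div_le_one hm0]; exact hm1) hd
    _ = expCount c n i := by field_simp

lemma sum_overlapTerm_le {c n m : ℕ} (hc : c ≤ 1) (hm : 2 ≤ m) (hmn : m ^ 11 ≤ n) :
    ∑ i ∈ Finset.Icc 2 m, overlapTerm c n m i ≤ 1 / m + 2 / expCount c n m := by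
  have hmn' : m ≤ n := (Nat.le_self_pow (by norm_num) m).trans hmn
  have hm0 : (0 : ℝ) < m := by exact_mod_cast (by omega : 0 < m)
  have hpos := expCount_pos (c := c) hmn'
  have hlast : overlapTerm c n m m = 1 / expCount c n m := by simp [overlapTerm_eq]
  rw [← Finset.Ico_insert_right hm, Finset.sum_insert (by simp), hlast]
  have hb : ∀ i ∈ Finset.Ico 2 m,
      overlapTerm c n m i ≤ 1 / m ^ 2 + 1 / (m * expCount c n m) := by
    intro i hi
    rw [Finset.mem_Ico] at hi
    rcases le_or_gt ((2 : ℝ) ^ (i - 1) * m ^ 8) (n ^ 2) with h | h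
    · exact (overlapTerm_le_of_small hi.1 hi.2.le hmn' h).trans
        (le_add_of_nonneg_right (by positivity))
    · exact (overlapTerm_le_of_large hc hi.1 hi.2 hmn h).trans
        (le_add_of_nonneg_left (by positivity))
  have hsum := Finset.sum_le_card_nsmul _ _ _ hb
  rw [Nat.card_Ico, nsmul_eq_mul] at hsum
  have hcard : ((m - 2 : ℕ) : ℝ) ≤ m := by exact_mod_cast Nat.sub_le _ _
  have : ((m - 2 : ℕ) : ℝ) * (1 / m ^ 2 + 1 / (m * expCount c n m)) ≤
      m * (1 / m ^ 2 + 1 / (m * expCount c n m)) := by gcongr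
  have e : (m : ℝ) * (1 / m ^ 2 + 1 / (m * expCount c n m)) = 1 / m + 1 / expCount c n m := by
    field_simp
  have e2 : 2 / expCount c n m = 1 / expCount c n m + 1 / expCount c n m := by ring
  linarith

lemma bernoulliBool_half_singleton (b : Bool) : bernoulliBool (1 / 2) {b} = 2⁻¹ := by
  have h : ((1 / 2 : ℝ).toNNReal : ENNReal) = 2⁻¹ := by
    change ENNReal.ofReal (1 / 2) = 2⁻¹
    rw [one_div, ENNReal.ofReal_inv_of_pos two_pos]
    simp
  have h' : (1 - 1 / 2 : ℝ) = 1 / 2 := by norm_num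
  unfold bernoulliBool
  rw [h', Measure.add_apply, Measure.smul_apply, Measure.smul_apply, ENNReal.smul_def,
    ENNReal.smul_def, h]
  cases b <;> simp

open Classical in
lemma erdosRenyi_half_apply (n : ℕ) (A : Set (Sym2 (Fin n) → Bool)) :
    (erdosRenyi n (1 / 2)).real A =
      (Finset.univ.filter (· ∈ A)).card / 2 ^ Fintype.card (Sym2 (Fin n)) := by
  have h : erdosRenyi n (1 / 2) A =
      (Finset.univ.filter (· ∈ A)).card * (2⁻¹) ^ Fintype.card (Sym2 (Fin n)) := by
    have hA : A = ((Finset.univ.filter (· ∈ A) : Finset _) : Set (Sym2 (Fin n) → Bool)) := by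
      ext; simp
    conv_lhs => rw [hA]
    rw [← sum_measure_singleton]
    have : ∀ ω : Sym2 (Fin n) → Bool,
        erdosRenyi n (1 / 2) {ω} = (2⁻¹) ^ Fintype.card (Sym2 (Fin n)) := by
      intro ω
      unfold erdosRenyi
      simp only [Measure.pi_singleton, bernoulliBool_half_singleton, Finset.prod_const,
        Finset.card_univ]
    simp only [this, Finset.sum_const, nsmul_eq_mul]
  rw [Measure.real, h]
  simp [div_eq_mul_inv]

lemma erdosRenyi_half_univ (n : ℕ) : erdosRenyi n (1 / 2) Set.univ = 1 := by
  unfold erdosRenyi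
  rw [Measure.pi_univ]
  have : bernoulliBool (1 / 2) Set.univ = 1 := by
    rw [← Finset.coe_univ, ← sum_measure_singleton]
    simp only [Fintype.sum_bool, bernoulliBool_half_singleton, ENNReal.inv_two_add_inv_two]
  rw [this]
  simp

open Classical in
/-- The number of solutions of a triangular system of parity constraints. -/
lemma card_constraints_mul {ι : Type*} [Fintype ι] (F : Finset ι)
    (L : ι → (ι → Bool) → Bool)
    (hL : ∀ ω ω' : ι → Bool, (∀ e ∉ F, ω e = ω' e) → ∀ e ∈ F, L e ω = L e ω') :
    (Finset.univ.filter fun ω : ι → Bool => ∀ e ∈ F, ω e = L e ω).card * 2 ^ F.card =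
      2 ^ Fintype.card ι := by
  let ψ : (ι → Bool) → ι → Bool := fun ω e => if e ∈ F then xor (ω e) (L e ω) else ω e
  have hψL : ∀ ω, ∀ e ∈ F, L e (ψ ω) = L e ω := fun ω =>
    hL _ _ fun e he => by simp [ψ, he]
  have hψ : ∀ ω, ψ (ψ ω) = ω := by
    intro ω
    funext e
    by_cases he : e ∈ F
    · have h1 : ψ (ψ ω) e = xor (ψ ω e) (L e (ψ ω)) := if_pos he
      have h2 : ψ ω e = xor (ω e) (L e ω) := if_pos he
      rw [h1, hψL ω e he, h2, Bool.xor_assoc, Bool.xor_self, Bool.xor_false]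
    · simp [ψ, he]
  have hcard : (Finset.univ.filter fun ω : ι → Bool => ∀ e ∈ F, ω e = L e ω).card =
      (Fintype.piFinset fun e => if e ∈ F then ({false} : Finset Bool) else Finset.univ).card := by
    refine Finset.card_nbij' ψ ψ ?_ ?_ (fun ω _ => hψ ω) (fun ω _ => hψ ω)
    · intro ω hω
      simp only [Finset.coe_filter, Finset.mem_univ, true_and, Set.mem_ofPred_eq] at hω
      simp only [Finset.mem_coe, Fintype.mem_piFinset]
      intro e
      by_cases he : e ∈ F
      · simp [ψ, he, ← hω e he]
      · simp [he]
    · intro ω hω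
      simp only [Finset.mem_coe, Fintype.mem_piFinset] at hω
      simp only [Finset.coe_filter, Finset.mem_univ, true_and, Set.mem_ofPred_eq]
      intro e he
      have := hω e
      simp only [he, if_true, Finset.mem_singleton] at this
      rw [hψL ω e he]
      simp [ψ, he, this]
  rw [hcard, Fintype.card_piFinset]
  have : ∀ e, (if e ∈ F then ({false} : Finset Bool) else Finset.univ).card =
      if e ∈ F then 1 else 2 := by
    intro e; split_ifs <;> simp
  simp only [this]
  rw [Finset.prod_ite]
  simp only [Finset.prod_const_one, one_mul, Finset.prod_const]
  rw [← pow_add, Finset.filter_not, Finset.card_sdiff_of_subset (Finset.filter_subset _ _)]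
  simp only [Finset.filter_univ_mem, Finset.card_univ]
  rw [Nat.sub_add_cancel (Finset.card_le_univ F)]

/-- The edges of the complete graph on `S`. -/
def pairs {V : Type*} [DecidableEq V] (S : Finset V) : Finset (Sym2 V) :=
  S.offDiag.image (Function.uncurry Sym2.mk)

section pairs

variable {V : Type*} [DecidableEq V]

lemma mk_mem_pairs {S : Finset V} {a b : V} :
    s(a, b) ∈ pairs S ↔ a ∈ S ∧ b ∈ S ∧ a ≠ b := by
  simp only [pairs, Finset.mem_image, Finset.mem_offDiag, Prod.exists, Function.uncurry_apply_pair,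
    Sym2.eq_iff]
  constructor
  · rintro ⟨x, y, ⟨hx, hy, hxy⟩, ⟨rfl, rfl⟩ | ⟨rfl, rfl⟩⟩
    · exact ⟨hx, hy, hxy⟩
    · exact ⟨hy, hx, hxy.symm⟩
  · rintro ⟨ha, hb, hab⟩
    exact ⟨a, b, ⟨ha, hb, hab⟩, Or.inl ⟨rfl, rfl⟩⟩

lemma card_pairs_union (S T : Finset V) :
    (pairs S ∪ pairs T).card + (S ∩ T).card.choose 2 = S.card.choose 2 + T.card.choose 2 := by
  have h : pairs S ∩ pairs T = pairs (S ∩ T) := by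
    ext e
    induction e with
    | _ a b => simp only [Finset.mem_inter, mk_mem_pairs]; tauto
  have hinter := Finset.card_union_add_card_inter (pairs S) (pairs T)
  rw [h] at hinter
  simpa only [pairs, Sym2.card_image_offDiag] using hinter

/-- The coin flips `ω` vanish on all edges inside `S`. -/
def IsEmptyOn (S : Finset V) (ω : Sym2 V → Bool) : Prop :=
  ∀ a ∈ S, ∀ b ∈ S, a ≠ b → ω s(a, b) = false

/-- On the edges inside `S` the coin flips `ω` are the indicator of a cut. -/
def IsCutOn (S : Finset V) (ω : Sym2 V → Bool) : Prop :=
  ∃ χ : V → Bool, ∀ a ∈ S, ∀ b ∈ S, a ≠ b → ω s(a, b) = xor (χ a) (χ b)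

/-- The sum of the coin flips on the edges joining the ends of an edge to their roots. -/
def rootParity (r : V → V) (e : Sym2 V) (ω : Sym2 V → Bool) : Bool :=
  Sym2.lift ⟨fun a b => xor (ω s(r a, a)) (ω s(r b, b)), fun _ _ => Bool.xor_comm _ _⟩ e

lemma isCutOn_iff_rootParity {S : Finset V} {u : V} (hu : u ∈ S) {r : V → V}
    (hr : ∀ a ∈ S, r a = u) (ω : Sym2 V → Bool) :
    IsCutOn S ω ↔ ∀ e ∈ pairs (S.erase u), ω e = rootParity r e ω := by
  constructor
  · rintro ⟨χ, h⟩ e he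
    induction e with
    | _ a b =>
      simp only [mk_mem_pairs, Finset.mem_erase] at he
      obtain ⟨⟨hau, ha⟩, ⟨hbu, hb⟩, hab⟩ := he
      simp only [rootParity, Sym2.lift_mk, hr a ha, hr b hb]
      rw [h a ha b hb hab, h u hu a ha hau.symm, h u hu b hb hbu.symm]
      cases χ a <;> cases χ b <;> cases χ u <;> rfl
  · intro h
    refine ⟨fun a => if a = u then false else ω s(u, a), fun a ha b hb hab => ?_⟩
    by_cases hau : a = u
    · subst hau; simp [hab.symm]
    by_cases hbu : b = u
    · subst hbu; simp [hab, Sym2.eq_swap]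
    have := h s(a, b) (by simp [mk_mem_pairs, *])
    simp only [rootParity, Sym2.lift_mk, hr a ha, hr b hb] at this
    simp [hau, hbu, this]

variable [Fintype V]

open Classical in
lemma card_isEmptyOn_inter {m : ℕ} {S T : Finset V} (hS : S.card = m) (hT : T.card = m) :
    (Finset.univ.filter fun ω => IsEmptyOn S ω ∧ IsEmptyOn T ω).card * 2 ^ (2 * (m - 0).choose 2) =
      2 ^ ((S ∩ T).card - 0).choose 2 * 2 ^ Fintype.card (Sym2 V) := by
  have h := card_constraints_mul (pairs S ∪ pairs T) (fun _ _ => false) (by simp)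
  have hc := card_pairs_union S T
  rw [hS, hT, ← two_mul] at hc
  have hiff : ∀ (S : Finset V) (ω : Sym2 V → Bool),
      IsEmptyOn S ω ↔ ∀ e ∈ pairs S, ω e = false := by
    intro S ω
    constructor
    · intro h e he
      induction e with
      | _ a b =>
        rw [mk_mem_pairs] at he
        exact h a he.1 b he.2.1 he.2.2
    · exact fun h a ha b hb hab => h _ (mk_mem_pairs.2 ⟨ha, hb, hab⟩)
  have hset : (Finset.univ.filter fun ω => IsEmptyOn S ω ∧ IsEmptyOn T ω) =
      Finset.univ.filter fun ω : Sym2 V → Bool => ∀ e ∈ pairs S ∪ pairs T, ω e = false := by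
    ext ω
    simp only [Finset.mem_filter, Finset.mem_univ, true_and, Finset.mem_union, or_imp,
      forall_and, hiff]
  have h' : (Finset.univ.filter fun ω => IsEmptyOn S ω ∧ IsEmptyOn T ω).card *
      2 ^ (pairs S ∪ pairs T).card = 2 ^ Fintype.card (Sym2 V) := by
    rw [hset]; convert h
  rw [Nat.sub_zero, Nat.sub_zero, ← hc, pow_add, ← mul_assoc, h', mul_comm]

open Classical in
lemma card_isCutOn_inter {m : ℕ} (hm : 1 ≤ m) {S T : Finset V} (hS : S.card = m)
    (hT : T.card = m) :
    (Finset.univ.filter fun ω => IsCutOn S ω ∧ IsCutOn T ω).card * 2 ^ (2 * (m - 1).choose 2) =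
      2 ^ ((S ∩ T).card - 1).choose 2 * 2 ^ Fintype.card (Sym2 V) := by
  obtain ⟨u, w, hu, hw, huw⟩ : ∃ u w, u ∈ S ∧ w ∈ T ∧ (u = w ∨ S ∩ T = ∅) := by
    rcases (S ∩ T).eq_empty_or_nonempty with h | ⟨v, hv⟩
    · obtain ⟨u, hu⟩ := Finset.card_pos.1 (by omega : 0 < S.card)
      obtain ⟨w, hw⟩ := Finset.card_pos.1 (by omega : 0 < T.card)
      exact ⟨u, w, hu, hw, Or.inr h⟩
    · rw [Finset.mem_inter] at hv
      exact ⟨v, v, hv.1, hv.2, Or.inl rfl⟩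
  let r : V → V := fun a => if a ∈ S then u else w
  have hrS : ∀ a ∈ S, r a = u := fun a ha => if_pos ha
  have hrT : ∀ a ∈ T, r a = w := by
    intro a ha
    by_cases haS : a ∈ S
    · rcases huw with rfl | h
      · exact hrS a haS
      · exact absurd (Finset.mem_inter.2 ⟨haS, ha⟩) (by simp [h])
    · exact if_neg haS
  have hnotin : ∀ a, (a ∈ S ∨ a ∈ T) → s(r a, a) ∉ pairs (S.erase u) ∪ pairs (T.erase w) := by
    intro a ha hmem
    simp only [Finset.mem_union, mk_mem_pairs, Finset.mem_erase] at hmem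
    rcases huw with rfl | h
    · have : r a = u := ha.elim (hrS a) (hrT a)
      rw [this] at hmem
      tauto
    · have hd : ∀ x ∈ S, x ∉ T := fun x hx hx' =>
        absurd (Finset.mem_inter.2 ⟨hx, hx'⟩) (by simp [h])
      rcases ha with ha | ha
      · rw [hrS a ha] at hmem
        have := hd a ha
        tauto
      · rw [hrT a ha] at hmem
        have : a ∉ S := fun h => hd a h ha
        tauto
  have h := card_constraints_mul (pairs (S.erase u) ∪ pairs (T.erase w)) (rootParity r) (by
    intro ω ω' hω e he
    induction e with
    | _ a b =>
      have hmem : (a ∈ S ∨ a ∈ T) ∧ (b ∈ S ∨ b ∈ T) := by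
        simp only [Finset.mem_union, mk_mem_pairs, Finset.mem_erase] at he
        tauto
      simp only [rootParity, Sym2.lift_mk]
      rw [hω _ (hnotin a hmem.1), hω _ (hnotin b hmem.2)])
  have hc := card_pairs_union (S.erase u) (T.erase w)
  have hi : (S.erase u ∩ T.erase w).card = (S ∩ T).card - 1 := by
    rcases huw with rfl | h
    · have : S.erase u ∩ T.erase u = (S ∩ T).erase u := by
        ext x; simp only [Finset.mem_inter, Finset.mem_erase]; tauto
      rw [this, Finset.card_erase_of_mem (Finset.mem_inter.2 ⟨hu, hw⟩)]
    · have : S.erase u ∩ T.erase w ⊆ S ∩ T :=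
        Finset.inter_subset_inter (Finset.erase_subset _ _) (Finset.erase_subset _ _)
      rw [h, Finset.subset_empty] at this
      rw [this, h]; rfl
  rw [Finset.card_erase_of_mem hu, Finset.card_erase_of_mem hw, hS, hT, ← two_mul, hi] at hc
  have hset : (Finset.univ.filter fun ω => IsCutOn S ω ∧ IsCutOn T ω) =
      Finset.univ.filter fun ω : Sym2 V → Bool =>
        ∀ e ∈ pairs (S.erase u) ∪ pairs (T.erase w), ω e = rootParity r e ω := by
    ext ω
    simp only [Finset.mem_filter, Finset.mem_univ, true_and, Finset.mem_union, or_imp,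
      forall_and, isCutOn_iff_rootParity hu hrS, isCutOn_iff_rootParity hw hrT]
  have h' : (Finset.univ.filter fun ω => IsCutOn S ω ∧ IsCutOn T ω).card *
      2 ^ (pairs (S.erase u) ∪ pairs (T.erase w)).card = 2 ^ Fintype.card (Sym2 V) := by
    rw [hset]; convert h
  rw [← hc, pow_add, ← mul_assoc, h', mul_comm]

end pairs

section moments

variable {Ω : Type*} [Fintype Ω]

open Classical in
/-- Chebyshev's inequality for a sum of indicators, in counting form. -/
lemma card_forall_not_mul_le {T : Type*} (I : Finset T) (E : T → Ω → Prop) {p : ℝ} (hp : 0 < p)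
    (w : T → T → ℝ)
    (h1 : ∀ S ∈ I, ((Finset.univ.filter fun ω => E S ω).card : ℝ) = p * Fintype.card Ω)
    (h2 : ∀ S ∈ I, ∀ S' ∈ I, ((Finset.univ.filter fun ω => E S ω ∧ E S' ω).card : ℝ) =
      p ^ 2 * w S S' * Fintype.card Ω) :
    ((Finset.univ.filter fun ω => ∀ S ∈ I, ¬ E S ω).card : ℝ) * (I.card : ℝ) ^ 2 ≤
      Fintype.card Ω * ∑ S ∈ I, ∑ S' ∈ I, (w S S' - 1) := by
  let X : Ω → ℝ := fun ω => ∑ S ∈ I, if E S ω then 1 else 0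
  have hX1 : ∑ ω, X ω = I.card * (p * Fintype.card Ω) := by
    rw [Finset.sum_comm, ← nsmul_eq_mul, ← Finset.sum_const]
    refine Finset.sum_congr rfl fun S hS => ?_
    rw [← h1 S hS, Finset.sum_boole]
  have hX2 : ∑ ω, X ω ^ 2 = p ^ 2 * Fintype.card Ω * ∑ S ∈ I, ∑ S' ∈ I, w S S' := by
    simp only [X, sq (∑ S ∈ I, _), Finset.sum_mul_sum]
    rw [Finset.sum_comm, Finset.mul_sum]
    refine Finset.sum_congr rfl fun S hS => ?_
    rw [Finset.sum_comm, Finset.mul_sum]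
    refine Finset.sum_congr rfl fun S' hS' => ?_
    have : ∀ ω, (if E S ω then (1 : ℝ) else 0) * (if E S' ω then 1 else 0) =
        if E S ω ∧ E S' ω then 1 else 0 := by
      intro ω; by_cases a : E S ω <;> by_cases b : E S' ω <;> simp [a, b]
    simp only [this, Finset.sum_boole]
    rw [h2 S hS S' hS']
    ring
  have hvar : ∑ ω, (X ω - I.card * p) ^ 2 =
      p ^ 2 * (Fintype.card Ω * ∑ S ∈ I, ∑ S' ∈ I, (w S S' - 1)) := by
    have : ∀ ω, (X ω - I.card * p) ^ 2 = X ω ^ 2 - 2 * (I.card * p) * X ω + (I.card * p) ^ 2 := by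
      intro ω; ring
    simp only [this, Finset.sum_add_distrib, Finset.sum_sub_distrib, ← Finset.mul_sum, hX1, hX2,
      Finset.sum_const, nsmul_eq_mul, Finset.card_univ, mul_one]
    ring
  have hlow : ((Finset.univ.filter fun ω => ∀ S ∈ I, ¬ E S ω).card : ℝ) * (I.card * p) ^ 2 ≤
      ∑ ω, (X ω - I.card * p) ^ 2 := by
    rw [← nsmul_eq_mul, ← Finset.sum_const (M := ℝ)]
    refine le_trans (le_of_eq ?_) (Finset.sum_le_sum_of_subset_of_nonneg
      (Finset.filter_subset (fun ω => ∀ S ∈ I, ¬ E S ω) _) fun _ _ _ => sq_nonneg _)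
    refine Finset.sum_congr rfl fun ω hω => ?_
    have hω' := (Finset.mem_filter.1 hω).2
    have : X ω = 0 := Finset.sum_eq_zero fun S hS => if_neg (hω' S hS)
    rw [this]; ring
  rw [hvar] at hlow
  refine le_of_mul_le_mul_left ?_ (show 0 < p ^ 2 by positivity)
  linarith

variable {V : Type*} [DecidableEq V]

lemma sum_overlap_le [Fintype V] {m c : ℕ} (S : Finset V) (hS : S.card = m) (hm : m ≤ Fintype.card V) :
    ∑ T ∈ Finset.powersetCard m Finset.univ, ((2 : ℝ) ^ ((S ∩ T).card - c).choose 2 - 1) ≤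
      (Fintype.card V).choose m * ∑ i ∈ Finset.Icc 2 m, overlapTerm c (Fintype.card V) m i := by
  have hterm : ∀ T ∈ Finset.powersetCard m (Finset.univ : Finset V),
      ((2 : ℝ) ^ ((S ∩ T).card - c).choose 2 - 1) ≤
      ∑ i ∈ Finset.Icc 2 m, ∑ I ∈ Finset.powersetCard i S,
        if I ⊆ T then (2 : ℝ) ^ (i - c).choose 2 else 0 := by
    intro T hT
    have hnn : ∀ i, ∀ I ∈ Finset.powersetCard i S,
        (0 : ℝ) ≤ if I ⊆ T then (2 : ℝ) ^ (i - c).choose 2 else 0 := by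
      intro i I _; split_ifs <;> positivity
    by_cases h : 2 ≤ (S ∩ T).card
    · have hle : (S ∩ T).card ≤ m := hS ▸ Finset.card_le_card Finset.inter_subset_left
      refine le_trans ?_ (Finset.single_le_sum (fun i _ => Finset.sum_nonneg (hnn i))
        (Finset.mem_Icc.2 ⟨h, hle⟩))
      refine le_trans ?_ (Finset.single_le_sum (hnn _)
        (Finset.mem_powersetCard.2 ⟨Finset.inter_subset_left, rfl⟩))
      rw [if_pos Finset.inter_subset_right]
      linarith
    · rw [Nat.choose_eq_zero_of_lt (by omega)]
      simpa using Finset.sum_nonneg fun i _ => Finset.sum_nonneg (hnn i)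
  refine (Finset.sum_le_sum hterm).trans ?_
  rw [Finset.sum_comm, Finset.mul_sum]
  refine Finset.sum_le_sum fun i hi => ?_
  rw [Finset.mem_Icc] at hi
  rw [Finset.sum_comm]
  have hI : ∀ I ∈ Finset.powersetCard i S,
      ∑ T ∈ Finset.powersetCard m Finset.univ,
        (if I ⊆ T then (2 : ℝ) ^ (i - c).choose 2 else 0) =
      (Fintype.card V - i).choose (m - i) * 2 ^ (i - c).choose 2 := by
    intro I hI
    rw [Finset.mem_powersetCard] at hI
    rw [← Finset.sum_filter, Finset.sum_const, nsmul_eq_mul,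
      Finset.card_filter_powersetCard_subset _ _ _ (Finset.subset_univ I) (by omega),
      Finset.card_univ, hI.2]
  rw [Finset.sum_congr rfl hI, Finset.sum_const, Finset.card_powersetCard, nsmul_eq_mul, hS]
  have hch := congrArg (Nat.cast (R := ℝ)) (Nat.choose_mul (n := Fintype.card V) hi.2)
  push_cast at hch
  have hpos : (0 : ℝ) < (Fintype.card V).choose i := by
    exact_mod_cast Nat.choose_pos (hi.2.trans hm)
  unfold overlapTerm
  rw [mul_div_assoc', le_div_iff₀ hpos]
  apply le_of_eq
  linear_combination -((m.choose i : ℝ) * 2 ^ (i - c).choose 2) * hch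

variable (E : Finset V → Ω → Prop) {c m : ℕ}

lemma real_mul_half_pow {a b x N : ℝ} {k : ℕ} (h : a * 2 ^ (2 * k) = x * N) (hb : b = 1 / 2 ^ k) :
    a = b ^ 2 * x * N := by
  subst hb
  rw [mul_comm 2 k, pow_mul] at h
  field_simp
  linarith

open Classical in
/-- `E S` behaves, for sets `S` of size `m`, as a system of `(m - c).choose 2` independent parity
constraints, with `(i - c).choose 2` constraints shared by two sets overlapping in `i` vertices. -/
def HasOverlapCount (c m : ℕ) : Prop :=
  ∀ S T : Finset V, S.card = m → T.card = m →
    (Finset.univ.filter fun ω => E S ω ∧ E T ω).card * 2 ^ (2 * (m - c).choose 2) =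
      2 ^ ((S ∩ T).card - c).choose 2 * Fintype.card Ω

variable {E}

open Classical in
lemma HasOverlapCount.card_inter (hE : HasOverlapCount E c m) {S T : Finset V}
    (hS : S.card = m) (hT : T.card = m) :
    ((Finset.univ.filter fun ω => E S ω ∧ E T ω).card : ℝ) =
      (1 / 2 ^ (m - c).choose 2) ^ 2 * 2 ^ ((S ∩ T).card - c).choose 2 * Fintype.card Ω :=
  real_mul_half_pow (k := (m - c).choose 2) (by exact_mod_cast hE S T hS hT) rfl

open Classical in
lemma HasOverlapCount.card_eq (hE : HasOverlapCount E c m) {S : Finset V} (hS : S.card = m) :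
    ((Finset.univ.filter fun ω => E S ω).card : ℝ) =
      1 / 2 ^ (m - c).choose 2 * Fintype.card Ω := by
  have := hE.card_inter hS hS
  simp only [and_self, Finset.inter_self, hS] at this
  rw [this]
  field_simp

open Classical in
lemma HasOverlapCount.card_forall_not_le [Fintype V] (hE : HasOverlapCount E c m) (hm : m ≤ Fintype.card V) :
    ((Finset.univ.filter fun ω => ∀ S : Finset V, S.card = m → ¬ E S ω).card : ℝ) ≤
      Fintype.card Ω * ∑ i ∈ Finset.Icc 2 m, overlapTerm c (Fintype.card V) m i := by
  have h := card_forall_not_mul_le (Finset.powersetCard m Finset.univ) E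
    (p := 1 / 2 ^ (m - c).choose 2) (by positivity)
    (fun S T => (2 : ℝ) ^ ((S ∩ T).card - c).choose 2)
    (fun S hS => hE.card_eq (Finset.mem_powersetCard.1 hS).2)
    (fun S hS T hT => hE.card_inter (Finset.mem_powersetCard.1 hS).2
      (Finset.mem_powersetCard.1 hT).2)
  have hsum := Finset.sum_le_card_nsmul (Finset.powersetCard m (Finset.univ : Finset V))
    (fun S => ∑ T ∈ Finset.powersetCard m Finset.univ,
      ((2 : ℝ) ^ ((S ∩ T).card - c).choose 2 - 1)) _
    fun S hS => sum_overlap_le (c := c) S (Finset.mem_powersetCard.1 hS).2 hm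
  have hpos : (0 : ℝ) < (Fintype.card V).choose m := by exact_mod_cast Nat.choose_pos hm
  simp only [Finset.mem_powersetCard, Finset.subset_univ, true_and, Finset.card_powersetCard,
    Finset.card_univ, nsmul_eq_mul] at h hsum
  refine le_of_mul_le_mul_right (h.trans ?_) (pow_pos hpos 2)
  refine (mul_le_mul_of_nonneg_left hsum (Nat.cast_nonneg _)).trans (le_of_eq ?_)
  ring

open Classical in
lemma HasOverlapCount.card_exists_le [Fintype V] (hE : HasOverlapCount E c m) :
    ((Finset.univ.filter fun ω => ∃ S : Finset V, S.card = m ∧ E S ω).card : ℝ) ≤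
      Fintype.card Ω * expCount c (Fintype.card V) m := by
  have hsub : (Finset.univ.filter fun ω => ∃ S : Finset V, S.card = m ∧ E S ω) ⊆
      (Finset.powersetCard m Finset.univ).biUnion fun S => Finset.univ.filter fun ω => E S ω := by
    intro ω hω
    obtain ⟨S, hS, hES⟩ := (Finset.mem_filter.1 hω).2
    exact Finset.mem_biUnion.2 ⟨S, Finset.mem_powersetCard.2 ⟨Finset.subset_univ S, hS⟩,
      Finset.mem_filter.2 ⟨Finset.mem_univ ω, hES⟩⟩
  have h1 := (Finset.card_le_card hsub).trans Finset.card_biUnion_le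
  refine (Nat.cast_le (α := ℝ).2 h1).trans (le_of_eq ?_)
  rw [Nat.cast_sum, Finset.sum_congr rfl fun S hS => hE.card_eq (Finset.mem_powersetCard.1 hS).2,
    Finset.sum_const, Finset.card_powersetCard, Finset.card_univ, nsmul_eq_mul, expCount]
  ring

end moments

lemma hasOverlapCount_isEmptyOn (n m : ℕ) :
    HasOverlapCount (IsEmptyOn (V := Fin n)) 0 m := by
  intro S T hS hT
  have := card_isEmptyOn_inter hS hT
  rwa [Fintype.card_fun, Fintype.card_bool]

lemma hasOverlapCount_isCutOn (n : ℕ) {m : ℕ} (hm : 1 ≤ m) :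
    HasOverlapCount (IsCutOn (V := Fin n)) 1 m := by
  intro S T hS hT
  have := card_isCutOn_inter hm hS hT
  rwa [Fintype.card_fun, Fintype.card_bool]

lemma HasOverlapCount.prob_forall_not_le {n c m : ℕ}
    {E : Finset (Fin n) → (Sym2 (Fin n) → Bool) → Prop} (hE : HasOverlapCount E c m)
    (hc : c ≤ 1) (hm : 2 ≤ m) (hmn : m ^ 11 ≤ n) :
    (erdosRenyi n (1 / 2)).real {ω | ∀ S : Finset (Fin n), S.card = m → ¬ E S ω} ≤
      1 / m + 2 / expCount c n m := by
  have hmn' : m ≤ n := (Nat.le_self_pow (by norm_num) m).trans hmn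
  have h := hE.card_forall_not_le (by simpa using hmn')
  rw [erdosRenyi_half_apply, div_le_iff₀ (by positivity)]
  simp only [Set.mem_ofPred_eq]
  refine (le_of_eq (by congr!)).trans (h.trans ?_)
  rw [Fintype.card_fun, Fintype.card_bool, Fintype.card_fin, mul_comm]
  push_cast
  gcongr
  exact sum_overlapTerm_le hc hm hmn

lemma HasOverlapCount.prob_exists_le {n c m : ℕ}
    {E : Finset (Fin n) → (Sym2 (Fin n) → Bool) → Prop} (hE : HasOverlapCount E c m) :
    (erdosRenyi n (1 / 2)).real {ω | ∃ S : Finset (Fin n), S.card = m ∧ E S ω} ≤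
      expCount c n m := by
  have h := hE.card_exists_le
  rw [erdosRenyi_half_apply, div_le_iff₀ (by positivity)]
  simp only [Set.mem_ofPred_eq]
  refine (le_of_eq (by congr!)).trans (h.trans (le_of_eq ?_))
  rw [Fintype.card_fun, Fintype.card_bool, Fintype.card_fin, mul_comm]
  push_cast
  rfl

section deterministic

variable {n : ℕ} {ω : Sym2 (Fin n) → Bool}

lemma graphOf_adj {a b : Fin n} : (graphOf n ω).Adj a b ↔ ω s(a, b) = true ∧ a ≠ b := by
  simp [graphOf]

lemma isIndepFinset_iff_isEmptyOn {S : Finset (Fin n)} :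
    IsIndepFinset (graphOf n ω) S ↔ IsEmptyOn S ω := by
  simp only [IsIndepFinset, IsEmptyOn, graphOf_adj, not_and, ← Bool.not_eq_true]
  exact forall₄_congr fun _ _ _ _ => by tauto

lemma IsCutOn.of_isInducedCompleteBipartite {S A B : Finset (Fin n)}
    (h : IsInducedCompleteBipartite (graphOf n ω) S A B) : IsCutOn S ω := by
  obtain ⟨-, -, hAB, hS, h⟩ := h
  refine ⟨fun a => decide (a ∈ A), fun a ha b hb hab => ?_⟩
  have hmem : ∀ x ∈ S, x ∈ A ∨ x ∈ B := fun x hx => by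
    have : x ∈ (A : Set (Fin n)) ∪ B := hS ▸ hx
    simpa using this
  have hd : ∀ x, x ∈ A → x ∈ B → False := fun x h h' =>
    Finset.disjoint_left.1 hAB h h'
  have h1 := h a ha b hb
  rw [graphOf_adj] at h1
  have h2 := hmem a ha
  have h3 := hmem b hb
  have h4 := hd a
  have h5 := hd b
  rw [Bool.eq_iff_iff]
  by_cases haA : a ∈ A <;> by_cases hbA : b ∈ A <;> simp [haA, hbA] <;> grind

lemma exists_isInducedCompleteBipartite {S : Finset (Fin n)} (h : IsCutOn S ω)
    (h' : ¬ IsEmptyOn S ω) :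
    ∃ A B : Finset (Fin n), IsInducedCompleteBipartite (graphOf n ω) S A B := by
  obtain ⟨χ, h⟩ := h
  have hne : ∃ a ∈ S, ∃ b ∈ S, χ a = true ∧ χ b = false := by
    simp only [IsEmptyOn, not_forall, Bool.not_eq_false] at h'
    obtain ⟨a, ha, b, hb, hab, he⟩ := h'
    rw [h a ha b hb hab] at he
    cases hχa : χ a <;> cases hχb : χ b
    · simp [hχa, hχb] at he
    · exact ⟨b, hb, a, ha, hχb, hχa⟩
    · exact ⟨a, ha, b, hb, hχa, hχb⟩
    · simp [hχa, hχb] at he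
  obtain ⟨a, ha, b, hb, hχa, hχb⟩ := hne
  refine ⟨S.filter (χ · = true), S.filter (χ · = false), ⟨a, by simp [*]⟩, ⟨b, by simp [*]⟩,
    ?_, ?_, ?_⟩
  · rw [Finset.disjoint_left]
    intro x hx hx'
    simp_all
  · ext x
    cases hx : χ x <;> simp [hx]
  · intro x hx y hy
    rw [graphOf_adj]
    by_cases hxy : x = y
    · subst hxy
      cases hχ : χ x <;> simp [hχ]
    · rw [h x hx y hy hxy]
      cases hχx : χ x <;> cases hχy : χ y <;> simp [*]

lemma alpha_eq {k : ℕ} (h : ∃ S : Finset (Fin n), S.card = k ∧ IsEmptyOn S ω)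
    (h' : ¬ ∃ S : Finset (Fin n), S.card = k + 1 ∧ IsEmptyOn S ω) :
    alpha (graphOf n ω) = k := by
  refine IsGreatest.csSup_eq ⟨?_, ?_⟩
  · obtain ⟨S, hS, hE⟩ := h
    exact ⟨S, hS, isIndepFinset_iff_isEmptyOn.2 hE⟩
  · rintro l ⟨S, rfl, hS⟩
    by_contra! hlt
    obtain ⟨T, hTS, hT⟩ := Finset.exists_subset_card_eq (n := k + 1) (s := S) hlt
    rw [isIndepFinset_iff_isEmptyOn] at hS
    exact h' ⟨T, hT, fun a ha b hb => hS a (hTS ha) b (hTS hb)⟩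

lemma beta_eq {k : ℕ} (h : ∃ S : Finset (Fin n), S.card = k + 2 ∧ IsCutOn S ω)
    (h' : ¬ ∃ S : Finset (Fin n), S.card = k + 3 ∧ IsCutOn S ω)
    (h'' : ¬ ∃ S : Finset (Fin n), S.card = k + 1 ∧ IsEmptyOn S ω) :
    beta (graphOf n ω) = k + 2 := by
  refine IsGreatest.csSup_eq ⟨?_, ?_⟩
  · obtain ⟨S, hS, hE⟩ := h
    obtain ⟨A, B, hAB⟩ := exists_isInducedCompleteBipartite hE fun hS' => by
      obtain ⟨T, hTS, hT⟩ := Finset.exists_subset_card_eq (n := k + 1) (s := S) (by omega)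
      exact h'' ⟨T, hT, fun a ha b hb => hS' a (hTS ha) b (hTS hb)⟩
    exact ⟨S, A, B, hAB, hS⟩
  · rintro l ⟨S, A, B, hAB, rfl⟩
    by_contra! hlt
    obtain ⟨T, hTS, hT⟩ := Finset.exists_subset_card_eq (n := k + 3) (s := S) hlt
    obtain ⟨χ, hχ⟩ := IsCutOn.of_isInducedCompleteBipartite hAB
    exact h' ⟨T, hT, χ, fun a ha b hb => hχ a (hTS ha) b (hTS hb)⟩

lemma tau_le_card {V ι : Type*} [Fintype ι] {G : SimpleGraph V} (P : ι → Finset V × Finset V)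
    (h1 : ∀ i, IsBicliqueIn G (P i).1 (P i).2)
    (h2 : ∀ i j, i ≠ j →
      Disjoint (bicliqueEdges (P i).1 (P i).2) (bicliqueEdges (P j).1 (P j).2))
    (h3 : (⋃ i, bicliqueEdges (P i).1 (P i).2) = G.edgeSet) : tau G ≤ Fintype.card ι := by
  refine Nat.sInf_le ⟨P ∘ (Fintype.equivFin ι).symm, fun i => h1 _, fun i j hij => h2 _ _ ?_, ?_⟩
  · simpa using hij
  · rw [← h3]
    exact (Fintype.equivFin ι).symm.surjective.iUnion_comp
      (fun i => bicliqueEdges (P i).1 (P i).2)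

open Classical in
/-- The vertices of an induced complete bipartite subgraph are covered by one biclique and each
other vertex contributes at most one star. -/
lemma tau_le_of_isInducedCompleteBipartite {G : SimpleGraph (Fin n)} {S A B : Finset (Fin n)}
    (h : IsInducedCompleteBipartite G S A B) : tau G ≤ n - S.card + 1 := by
  obtain ⟨hA, hB, hd, hS, hadj⟩ := h
  have hmem : ∀ x, x ∈ S ↔ x ∈ A ∨ x ∈ B := fun x => by
    have : x ∈ (A : Set (Fin n)) ∪ B ↔ x ∈ (S : Set (Fin n)) := by rw [hS]
    simpa using this.symm
  let N : Fin n → Finset (Fin n) := fun v => Finset.univ.filter fun u => G.Adj v u ∧ (u ∈ S ∨ v < u)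
  let W : Finset (Fin n) := Finset.univ.filter fun v => v ∉ S ∧ (N v).Nonempty
  let P : Option W → Finset (Fin n) × Finset (Fin n) := fun i => i.elim (A, B) fun v => ({v.1}, N v)
  have hPnone : ∀ a b, s(a, b) ∈ bicliqueEdges (P none).1 (P none).2 ↔
      G.Adj a b ∧ a ∈ S ∧ b ∈ S := by
    intro a b
    constructor
    · rintro ⟨x, hx, y, hy, e⟩
      have hxS := (hmem x).2 (Or.inl hx)
      have hyS := (hmem y).2 (Or.inr hy)
      have hxy := (hadj x hxS y hyS).2 (Or.inl ⟨hx, hy⟩)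
      rcases Sym2.eq_iff.1 e with ⟨rfl, rfl⟩ | ⟨rfl, rfl⟩
      · exact ⟨hxy, hxS, hyS⟩
      · exact ⟨hxy.symm, hyS, hxS⟩
    · rintro ⟨hab, ha, hb⟩
      rcases (hadj a ha b hb).1 hab with ⟨h1, h2⟩ | ⟨h1, h2⟩
      · exact ⟨a, h1, b, h2, rfl⟩
      · exact ⟨b, h2, a, h1, Sym2.eq_swap⟩
  have hPsome : ∀ (v : W) a b, s(a, b) ∈ bicliqueEdges (P (some v)).1 (P (some v)).2 ↔
      G.Adj a b ∧ ((a = v ∧ (b ∈ S ∨ a < b)) ∨ (b = v ∧ (a ∈ S ∨ b < a))) := by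
    intro v a b
    simp only [bicliqueEdges, P, Option.elim, Finset.mem_singleton, exists_eq_left, N,
      Finset.mem_filter, Finset.mem_univ, true_and, Set.mem_ofPred_eq, Sym2.eq_iff]
    constructor
    · rintro ⟨u, ⟨hvu, hu⟩, ⟨rfl, rfl⟩ | ⟨rfl, rfl⟩⟩
      · exact ⟨hvu, Or.inl ⟨rfl, hu⟩⟩
      · exact ⟨hvu.symm, Or.inr ⟨rfl, hu⟩⟩
    · rintro ⟨hab, ⟨rfl, hu⟩ | ⟨rfl, hu⟩⟩
      · exact ⟨b, ⟨hab, hu⟩, Or.inl ⟨rfl, rfl⟩⟩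
      · exact ⟨a, ⟨hab.symm, hu⟩, Or.inr ⟨rfl, rfl⟩⟩
  have hWS : ∀ v : W, v.1 ∉ S := fun v => (Finset.mem_filter.1 v.2).2.1
  have hcard : Fintype.card (Option W) ≤ n - S.card + 1 := by
    rw [Fintype.card_option, Fintype.card_coe]
    have : W ⊆ Sᶜ := fun v hv => Finset.mem_compl.2 (Finset.mem_filter.1 hv).2.1
    have := Finset.card_le_card this
    rw [Finset.card_compl, Fintype.card_fin] at this
    omega
  refine (tau_le_card P ?_ ?_ ?_).trans hcard
  · rintro (_ | v)
    · exact ⟨hA, hB, hd, fun a ha b hb =>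
        (hadj a ((hmem a).2 (Or.inl ha)) b ((hmem b).2 (Or.inr hb))).2 (Or.inl ⟨ha, hb⟩)⟩
    · refine ⟨Finset.singleton_nonempty _, (Finset.mem_filter.1 v.2).2.2, ?_, ?_⟩
      · simp [P, N]
      · intro a ha b hb
        rw [Finset.mem_singleton.1 ha]
        exact (Finset.mem_filter.1 hb).2.1
  · rintro i j hij
    rw [Set.disjoint_left]
    intro e
    induction e with
    | _ a b =>
      rcases i with _ | v <;> rcases j with _ | w
      · exact absurd rfl hij
      · rw [hPnone, hPsome]
        have := hWS w
        rintro ⟨-, ha, hb⟩ ⟨-, ⟨rfl, -⟩ | ⟨rfl, -⟩⟩ <;> contradiction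
      · rw [hPnone, hPsome]
        have := hWS v
        rintro ⟨-, ⟨rfl, -⟩ | ⟨rfl, -⟩⟩ ⟨-, ha, hb⟩ <;> contradiction
      · rw [hPsome, hPsome]
        have hv := hWS v
        have hw := hWS w
        have hvw : v.1 ≠ w.1 := fun h => hij (congrArg some (Subtype.ext h))
        rintro ⟨-, ⟨h1, h2⟩ | ⟨h1, h2⟩⟩ ⟨-, ⟨h3, h4⟩ | ⟨h3, h4⟩⟩
        · exact hvw (h1.symm.trans h3)
        · rw [← h1] at hv; rw [← h3] at hw
          exact lt_asymm (h2.resolve_left hw) (h4.resolve_left hv)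
        · rw [← h1] at hv; rw [← h3] at hw
          exact lt_asymm (h2.resolve_left hw) (h4.resolve_left hv)
        · exact hvw (h1.symm.trans h3)
  · ext e
    induction e with
    | _ a b =>
      rw [Set.mem_iUnion, SimpleGraph.mem_edgeSet]
      constructor
      · rintro ⟨_ | v, hi⟩
        · exact ((hPnone a b).1 hi).1
        · exact ((hPsome v a b).1 hi).1
      · intro hab
        have hstar : ∀ x y, G.Adj x y → x ∉ S → (y ∈ S ∨ x < y) →
            ∃ i, s(x, y) ∈ bicliqueEdges (P i).1 (P i).2 := by
          intro x y hxy hx hy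
          have hxW : x ∈ W := Finset.mem_filter.2 ⟨Finset.mem_univ x, hx,
            ⟨y, Finset.mem_filter.2 ⟨Finset.mem_univ y, hxy, hy⟩⟩⟩
          exact ⟨some ⟨x, hxW⟩, (hPsome _ _ _).2 ⟨hxy, Or.inl ⟨rfl, hy⟩⟩⟩
        by_cases ha : a ∈ S
        · by_cases hb : b ∈ S
          · exact ⟨none, (hPnone a b).2 ⟨hab, ha, hb⟩⟩
          · rw [Sym2.eq_swap]
            exact hstar b a hab.symm hb (Or.inl ha)
        · by_cases hb : b ∈ S ∨ a < b
          · exact hstar a b hab ha hb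
          · push Not at hb
            rw [Sym2.eq_swap]
            exact hstar b a hab.symm hb.1 (Or.inr (lt_of_le_of_ne hb.2 hab.ne'))

lemma tau_le_of_beta_eq {k : ℕ} {G : SimpleGraph (Fin n)}
    (hβ : beta G = k + 2) : tau G ≤ n - k - 1 := by
  have hbdd : BddAbove {k | ∃ S A B : Finset (Fin n), IsInducedCompleteBipartite G S A B ∧
      S.card = k} :=
    ⟨n, by rintro _ ⟨S, -, -, -, rfl⟩; simpa using S.card_le_univ⟩
  have hne : {k | ∃ S A B : Finset (Fin n), IsInducedCompleteBipartite G S A B ∧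
      S.card = k}.Nonempty := by
    by_contra h
    rw [Set.not_nonempty_iff_eq_empty] at h
    rw [beta, h] at hβ
    simp at hβ
  obtain ⟨S, A, B, hS, hcard⟩ := Nat.sSup_mem hne hbdd
  change S.card = beta G at hcard
  have h1 := tau_le_of_isInducedCompleteBipartite hS
  have h2 := S.card_le_univ
  rw [Fintype.card_fin] at h2
  omega

end deterministic

/-- A bound for the failure probability in terms of the expected numbers of independent sets
and of induced complete bipartite subgraphs. -/
lemma prob_compl_alpha_beta_le {n : ℕ} (hk : 2 ≤ k0 n) (hn : (k0 n + 2) ^ 11 ≤ n) :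
    (erdosRenyi n (1 / 2)).real
      {ω | alpha (graphOf n ω) = k0 n ∧ beta (graphOf n ω) = k0 n + 2}ᶜ ≤
      2 / (k0 n : ℝ) + 514 / f n (k0 n) + 2 * f n (k0 n + 1) := by
  have hn2 : 2 ≤ n := le_trans (by omega) ((Nat.le_self_pow (by norm_num) _).trans hn)
  have hf : 0 < f n (k0 n) := zero_lt_one.trans_le (one_le_f_k0 hn2)
  have hg := f_k0_le_expCount hk hn
  have hg' := expCount_le_f_k0_add_one hn2
  have b1 := (hasOverlapCount_isEmptyOn n (k0 n)).prob_forall_not_le (by norm_num) hk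
    ((Nat.pow_le_pow_left (by omega) 11).trans hn)
  have b2 := (hasOverlapCount_isEmptyOn n (k0 n + 1)).prob_exists_le
  have b3 := (hasOverlapCount_isCutOn n (m := k0 n + 2) (by omega)).prob_forall_not_le le_rfl
    (by omega) hn
  have b4 := (hasOverlapCount_isCutOn n (m := k0 n + 3) (by omega)).prob_exists_le
  rw [← f_eq_expCount] at b1 b2
  set k := k0 n
  have : IsFiniteMeasure (erdosRenyi n (1 / 2)) := ⟨by rw [erdosRenyi_half_univ]; simp⟩
  have hsub : {ω | alpha (graphOf n ω) = k ∧ beta (graphOf n ω) = k + 2}ᶜ ⊆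
      (({ω | ∀ S : Finset (Fin n), S.card = k → ¬ IsEmptyOn S ω} ∪
        {ω | ∃ S : Finset (Fin n), S.card = k + 1 ∧ IsEmptyOn S ω}) ∪
        {ω | ∀ S : Finset (Fin n), S.card = k + 2 → ¬ IsCutOn S ω}) ∪
        {ω | ∃ S : Finset (Fin n), S.card = k + 3 ∧ IsCutOn S ω} := by
    intro ω hω
    by_contra h
    simp only [Set.mem_union, Set.mem_ofPred_eq, not_or, not_forall, not_not] at h
    obtain ⟨⟨⟨⟨S, hS, hE⟩, h2⟩, ⟨S', hS', hE'⟩⟩, h4⟩ := h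
    exact hω ⟨alpha_eq ⟨S, hS, hE⟩ h2, beta_eq ⟨S', hS', hE'⟩ h4 h2⟩
  refine (measureReal_mono hsub).trans ?_
  refine (measureReal_union_le _ _).trans ?_
  have u1 := measureReal_union_le (μ := erdosRenyi n (1 / 2))
    ({ω | ∀ S : Finset (Fin n), S.card = k → ¬ IsEmptyOn S ω} ∪
        {ω | ∃ S : Finset (Fin n), S.card = k + 1 ∧ IsEmptyOn S ω})
    {ω | ∀ S : Finset (Fin n), S.card = k + 2 → ¬ IsCutOn S ω}
  have u2 := measureReal_union_le (μ := erdosRenyi n (1 / 2))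
    {ω | ∀ S : Finset (Fin n), S.card = k → ¬ IsEmptyOn S ω}
    {ω | ∃ S : Finset (Fin n), S.card = k + 1 ∧ IsEmptyOn S ω}
  have e1 : (1 : ℝ) / (k + 2 : ℕ) ≤ 1 / k := by
    have : (0 : ℝ) < k := by exact_mod_cast (by omega : 0 < k)
    push_cast
    gcongr
    linarith
  have e2 : 2 / expCount 1 n (k + 2) ≤ 512 / f n k := by
    rw [div_le_div_iff₀ (lt_of_lt_of_le (by positivity) hg) hf]
    linarith
  have e3 : 2 / (k : ℝ) = 1 / k + 1 / k := by ring
  have e4 : 514 / f n k = 2 / f n k + 512 / f n k := by ring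
  linarith

/-- along a sequence with `f(k₀) → ∞` and `f(k₀+1) → 0`, whp
`α(G) = k₀` and `β(G) = k₀ + 2`, and consequently whp `τ(G) ≤ n - α(G) - 1`. -/
theorem whp_alpha_k0_beta_k0_add_two
    (s : ℕ → ℕ) (hs : StrictMono s)
    (h1 : Tendsto (fun j => f (s j) (k0 (s j))) atTop atTop)
    (h2 : Tendsto (fun j => f (s j) (k0 (s j) + 1)) atTop (nhds 0)) :
    Tendsto (fun j => erdosRenyi (s j) (1/2)
      {ω | alpha (graphOf (s j) ω) = k0 (s j) ∧
           beta (graphOf (s j) ω) = k0 (s j) + 2}) atTop (nhds 1) ∧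
    Tendsto (fun j => erdosRenyi (s j) (1/2)
      {ω | tau (graphOf (s j) ω) ≤ s j - alpha (graphOf (s j) ω) - 1}) atTop (nhds 1) := by
  have hsT : Tendsto s atTop atTop := hs.tendsto_atTop
  have hprob : ∀ n, IsProbabilityMeasure (erdosRenyi n (1 / 2)) :=
    fun n => ⟨erdosRenyi_half_univ n⟩
  have hk : Tendsto (fun j => (k0 (s j) : ℝ)) atTop atTop :=
    tendsto_natCast_atTop_atTop.comp (tendsto_k0.comp hsT)
  have hbound : Tendsto (fun j => 1 - (2 / (k0 (s j) : ℝ) + 514 / f (s j) (k0 (s j)) +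
      2 * f (s j) (k0 (s j) + 1))) atTop (nhds 1) := by
    simpa using tendsto_const_nhds (x := (1 : ℝ)).sub
      (((hk.const_div_atTop 2).add (h1.const_div_atTop 514)).add (h2.const_mul 2))
  have hlow : ∀ᶠ j in atTop, ENNReal.ofReal (1 - (2 / (k0 (s j) : ℝ) +
      514 / f (s j) (k0 (s j)) + 2 * f (s j) (k0 (s j) + 1))) ≤
      erdosRenyi (s j) (1 / 2) {ω | alpha (graphOf (s j) ω) = k0 (s j) ∧
        beta (graphOf (s j) ω) = k0 (s j) + 2} := by
    filter_upwards [hsT.eventually eventually_pow_le_k0,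
      (tendsto_k0.comp hsT).eventually_ge_atTop 2] with j hj1 hj2
    have h := prob_compl_alpha_beta_le hj2 hj1
    rw [probReal_compl_eq_one_sub (Set.toFinite _).measurableSet] at h
    rw [← ofReal_measureReal]
    exact ENNReal.ofReal_le_ofReal (by linarith)
  have hlim := ENNReal.tendsto_ofReal hbound
  rw [ENNReal.ofReal_one] at hlim
  have hfirst := tendsto_of_tendsto_of_tendsto_of_le_of_le' hlim tendsto_const_nhds hlow
    (Eventually.of_forall fun j => prob_le_one)
  refine ⟨hfirst, tendsto_of_tendsto_of_tendsto_of_le_of_le' hfirst tendsto_const_nhds ?_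
    (Eventually.of_forall fun j => prob_le_one)⟩
  refine Eventually.of_forall fun j => measure_mono fun ω hω => ?_
  obtain ⟨hα, hβ⟩ := hω
  rw [← hα] at hβ
  exact tau_le_of_beta_eq hβ

end RandomBipartiteDecomposition
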